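/- Assume LICQ holds on S. Then f attains its infimum on S if and only if Σ(f,S) ≠ ∅ and min{f(x) : x ∈ Σ(f,S)} ≤ liminf_{t→+∞} ψ(t), where the liminf is taken in ℝ ∪ {±∞}. -/

import Mathlib

open Filter

noncomputable section

def IsPolyFun {n : ℕ} (f : EuclideanSpace ℝ (Fin n) → ℝ) : Prop :=
  ∃ P : MvPolynomial (Fin n) ℝ, ∀ x, f x = MvPolynomial.eval (fun i => x i) P

def conSet {n l m : ℕ} (g : Fin l → EuclideanSpace ℝ (Fin n) → ℝ)
    (h : Fin m → EuclideanSpace ℝ (Fin n) → ℝ) : Set (EuclideanSpace ℝ (Fin n)) :=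
  {x | (∀ i, g i x = 0) ∧ (∀ j, 0 ≤ h j x)}

def LICQ {n l m : ℕ} (g : Fin l → EuclideanSpace ℝ (Fin n) → ℝ)
    (h : Fin m → EuclideanSpace ℝ (Fin n) → ℝ) : Prop :=
  ∀ x ∈ conSet g h, LinearIndependent ℝ
    (Sum.elim (fun i : Fin l => gradient (g i) x)
      (fun j : {j : Fin m // h j x = 0} => gradient (h j.1) x))

def criticalSet {n l m : ℕ} (f : EuclideanSpace ℝ (Fin n) → ℝ)
    (g : Fin l → EuclideanSpace ℝ (Fin n) → ℝ)
    (h : Fin m → EuclideanSpace ℝ (Fin n) → ℝ) : Set (EuclideanSpace ℝ (Fin n)) :=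
  {x | x ∈ conSet g h ∧ ∃ (lam : Fin l → ℝ) (nu : Fin m → ℝ),
    gradient f x - ∑ i, lam i • gradient (g i) x - ∑ j, nu j • gradient (h j) x = 0 ∧
    ∀ j, nu j * h j x = 0}

def tangencySet {n l m : ℕ} (f : EuclideanSpace ℝ (Fin n) → ℝ)
    (g : Fin l → EuclideanSpace ℝ (Fin n) → ℝ)
    (h : Fin m → EuclideanSpace ℝ (Fin n) → ℝ) : Set (EuclideanSpace ℝ (Fin n)) :=
  {x | x ∈ conSet g h ∧ ∃ (κ : ℝ) (lam : Fin l → ℝ) (nu : Fin m → ℝ) (μ : ℝ),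
    (κ, lam, nu, μ) ≠ 0 ∧
    κ • gradient f x - ∑ i, lam i • gradient (g i) x - ∑ j, nu j • gradient (h j) x - μ • x = 0 ∧
    ∀ j, nu j * h j x = 0}

def tangencyValues {n l m : ℕ} (f : EuclideanSpace ℝ (Fin n) → ℝ)
    (g : Fin l → EuclideanSpace ℝ (Fin n) → ℝ)
    (h : Fin m → EuclideanSpace ℝ (Fin n) → ℝ) : Set ℝ :=
  {lam | ∃ x : ℕ → EuclideanSpace ℝ (Fin n), (∀ k, x k ∈ tangencySet f g h) ∧
    Tendsto (fun k => ‖x k‖) atTop atTop ∧ Tendsto (fun k => f (x k)) atTop (nhds lam)}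

def psi {n l m : ℕ} (f : EuclideanSpace ℝ (Fin n) → ℝ)
    (g : Fin l → EuclideanSpace ℝ (Fin n) → ℝ)
    (h : Fin m → EuclideanSpace ℝ (Fin n) → ℝ) (t : ℝ) : EReal :=
  sInf ((fun x => (f x : EReal)) '' {x | x ∈ conSet g h ∧ ‖x‖ = t})

def CoerciveOn {n : ℕ} (f : EuclideanSpace ℝ (Fin n) → ℝ)
    (S : Set (EuclideanSpace ℝ (Fin n))) : Prop :=
  ∀ x : ℕ → EuclideanSpace ℝ (Fin n), (∀ k, x k ∈ S) →
    Tendsto (fun k => ‖x k‖) atTop atTop → Tendsto (fun k => f (x k)) atTop atTop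

theorem isAlgebraic_of_kaehlerDifferential_D_eq_zero {k L : Type*} [Field k] [CharZero k] [Field L]
    [Algebra k L] [Algebra.EssFiniteType k L] {a : L} (ha : KaehlerDifferential.D k L a = 0) :
    IsAlgebraic k a := by
  by_contra htr
  have hinj : Function.Injective (Polynomial.aeval (R := k) a) := transcendental_iff_injective.1 htr
  let : Algebra (Polynomial k) L := (Polynomial.aeval (R := k) a).toAlgebra
  have : IsScalarTower k (Polynomial k) L :=
    .of_algebraMap_eq' (Polynomial.aeval (R := k) a).comp_algebraMap.symm
  have : FaithfulSMul (Polynomial k) L := (faithfulSMul_iff_algebraMap_injective _ _).2 hinj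
  let F := FractionRing (Polynomial k)
  let : Algebra F L := FractionRing.liftAlgebra (Polynomial k) L
  have : IsScalarTower (Polynomial k) F L := FractionRing.isScalarTower_liftAlgebra _ _
  have : IsScalarTower k F L := .of_algebraMap_eq fun x => by
    rw [IsScalarTower.algebraMap_apply k (Polynomial k) L,
      IsScalarTower.algebraMap_apply (Polynomial k) F L,
      ← IsScalarTower.algebraMap_apply k (Polynomial k) F]
  have : CharZero F := charZero_of_injective_algebraMap (algebraMap k F).injective
  have : Algebra.EssFiniteType F L := .of_comp k F L
  have : Algebra.FormallySmooth F L := .of_perfectField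
  have : Algebra.FormallySmooth (Polynomial k) F :=
    .of_isLocalization (nonZeroDivisors (Polynomial k))
  have : Algebra.FormallySmooth (Polynomial k) L := .comp _ F _
  have hbase : Function.Injective (KaehlerDifferential.mapBaseChange k (Polynomial k) L) := by
    rw [injective_iff_map_eq_zero]
    intro x hx
    obtain ⟨y, rfl⟩ := (Algebra.H1Cotangent.exact_δ_mapBaseChange k (Polynomial k) L x).1 hx
    rw [Subsingleton.elim y 0, map_zero]
  have h1 : (1 : L) ⊗ₜ[Polynomial k] KaehlerDifferential.D k (Polynomial k) Polynomial.X = 0 := by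
    apply hbase
    rw [KaehlerDifferential.mapBaseChange_tmul, KaehlerDifferential.map_D, map_zero, one_smul]
    have : algebraMap (Polynomial k) L Polynomial.X = a := Polynomial.aeval_X a
    rw [this, ha]
  have h2 := congrArg ((TensorProduct.rid (Polynomial k) L) ∘
    (KaehlerDifferential.polynomialEquiv k).toLinearMap.lTensor L) h1
  simp at h2

theorem MvPolynomial.derivation_eq_sum_pderiv {R σ A : Type*} [CommSemiring R] [Fintype σ]
    [AddCommMonoid A] [Module R A] [Module (MvPolynomial σ R) A]
    [IsScalarTower R (MvPolynomial σ R) A] (D : Derivation R (MvPolynomial σ R) A)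
    (p : MvPolynomial σ R) : D p = ∑ i, pderiv i p • D (X i) := by
  classical
  induction p using MvPolynomial.induction_on with
  | C a => simp
  | add p q hp hq => simp only [map_add, hp, hq, add_smul, Finset.sum_add_distrib]
  | mul_X p j hp =>
    simp only [Derivation.leibniz, hp, add_smul, Finset.sum_add_distrib, Finset.smul_sum, mul_smul,
      pderiv_X, Pi.single_apply, smul_eq_mul, mul_ite, mul_one, mul_zero, ite_smul, zero_smul,
      Finset.sum_ite_eq, Finset.mem_univ, if_true]

theorem MvPolynomial.finite_image_eval_of_pderiv_eq_zero {k σ : Type*} [Field k] [CharZero k]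
    [Finite σ] (p : MvPolynomial σ k) :
    ((fun x => eval x p) '' {x : σ → k | ∀ i, eval x (pderiv i p) = 0}).Finite := by
  cases nonempty_fintype σ
  let I : Ideal (MvPolynomial σ k) := Ideal.span (Set.range fun i => pderiv i p)
  have hP : ∀ P ∈ I.minimalPrimes, ∃ q : Polynomial k, q ≠ 0 ∧ Polynomial.aeval p q ∈ P := by
    intro P hP
    have : P.IsPrime := hP.1.1
    let L := FractionRing (MvPolynomial σ k ⧸ P)
    have hzero : KaehlerDifferential.D k L (algebraMap (MvPolynomial σ k) L p) = 0 := by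
      have h := derivation_eq_sum_pderiv
        ((KaehlerDifferential.D k L).compAlgebraMap (MvPolynomial σ k)) p
      rw [Derivation.compAlgebraMap_apply] at h
      rw [h]
      refine Finset.sum_eq_zero fun i _ => ?_
      rw [← algebraMap_smul L, IsScalarTower.algebraMap_apply _ (MvPolynomial σ k ⧸ P) L,
        Ideal.Quotient.algebraMap_eq, Ideal.Quotient.eq_zero_iff_mem.2, map_zero, zero_smul]
      exact hP.1.2 (Ideal.subset_span ⟨i, rfl⟩)
    obtain ⟨q, hq, hq0⟩ := isAlgebraic_of_kaehlerDifferential_D_eq_zero hzero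
    refine ⟨q, hq, ?_⟩
    rw [Polynomial.aeval_algebraMap_apply, IsScalarTower.algebraMap_apply _ (MvPolynomial σ k ⧸ P) L,
      FaithfulSMul.algebraMap_eq_zero_iff, Ideal.Quotient.algebraMap_eq,
      Ideal.Quotient.eq_zero_iff_mem] at hq0
    exact hq0
  choose! q hq0 hq using hP
  have hfin : I.minimalPrimes.Finite := I.finite_minimalPrimes_of_isNoetherianRing
  let Q : Polynomial k := ∏ P ∈ hfin.toFinset, q P
  have hQ0 : Q ≠ 0 := Finset.prod_ne_zero_iff.2 fun P hP => hq0 P (hfin.mem_toFinset.1 hP)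
  have hQ : Polynomial.aeval p Q ∈ I.radical := by
    rw [← Ideal.sInf_minimalPrimes, Submodule.mem_sInf]
    intro P hP
    rw [map_prod]
    exact Ideal.prod_mem _ (hfin.mem_toFinset.2 hP) (hq P hP)
  refine (Q.rootSet_finite k).subset ?_
  rintro _ ⟨x, hx, rfl⟩
  rw [Polynomial.mem_rootSet_of_ne hQ0]
  have hle : I.radical ≤ RingHom.ker (aeval (R := k) x) :=
    (RingHom.ker_isPrime _).radical_le_iff.2 <| Ideal.span_le.2 <| by
      rintro _ ⟨i, rfl⟩
      exact hx i
  have := hle hQ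
  rw [RingHom.mem_ker, ← Polynomial.aeval_algHom_apply] at this
  exact this

theorem MvPolynomial.hasStrictFDerivAt_eval {ι : Type*} [Fintype ι] (P : MvPolynomial ι ℝ)
    (x : EuclideanSpace ℝ ι) :
    HasStrictFDerivAt (fun y : EuclideanSpace ℝ ι => eval (fun i => y i) P)
      (∑ i, eval (fun i => x i) (pderiv i P) • EuclideanSpace.proj (𝕜 := ℝ) i) x := by
  classical
  induction P using MvPolynomial.induction_on with
  | C a => simpa using hasStrictFDerivAt_const a x
  | add p q hp hq => simpa [add_smul, Finset.sum_add_distrib] using! hp.add hq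
  | mul_X p j hp =>
    have hj : HasStrictFDerivAt (fun y : EuclideanSpace ℝ ι => y j)
      (EuclideanSpace.proj (𝕜 := ℝ) j) x := (EuclideanSpace.proj (𝕜 := ℝ) j).hasStrictFDerivAt
    convert! hp.mul hj using 1
    · ext y; simp
    · simp [Derivation.leibniz, add_smul, Finset.sum_add_distrib, Finset.smul_sum, mul_smul,
        pderiv_X, Pi.single_apply, apply_ite, ite_smul]

namespace IsPolyFun

variable {n : ℕ} {f : EuclideanSpace ℝ (Fin n) → ℝ}

theorem hasStrictFDerivAt (hf : IsPolyFun f) (x : EuclideanSpace ℝ (Fin n)) :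
    HasStrictFDerivAt f (InnerProductSpace.toDual ℝ _ (gradient f x)) x := by
  obtain ⟨P, hP⟩ := hf
  obtain rfl : f = fun x => MvPolynomial.eval (fun i => x i) P := funext hP
  have h := P.hasStrictFDerivAt_eval x
  rwa [toDual_gradient, h.hasFDerivAt.fderiv]

theorem continuous (hf : IsPolyFun f) : Continuous f :=
  continuous_iff_continuousAt.2 fun x => (hf.hasStrictFDerivAt x).continuousAt

end IsPolyFun

theorem gradient_apply_of_eq_eval {n : ℕ} {f : EuclideanSpace ℝ (Fin n) → ℝ}
    {P : MvPolynomial (Fin n) ℝ} (hP : ∀ x, f x = MvPolynomial.eval (fun i => x i) P)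
    (x : EuclideanSpace ℝ (Fin n)) (i : Fin n) :
    gradient f x i = MvPolynomial.eval (fun i => x i) (MvPolynomial.pderiv i P) := by
  obtain rfl : f = fun x => MvPolynomial.eval (fun i => x i) P := funext hP
  have h := inner_gradient_left (𝕜 := ℝ) (f := fun x : EuclideanSpace ℝ (Fin n) =>
    MvPolynomial.eval (fun i => x i) P) (x := x) (y := EuclideanSpace.single i (1 : ℝ))
  rw [EuclideanSpace.inner_single_right, (P.hasStrictFDerivAt_eval x).hasFDerivAt.fderiv] at h
  simpa [Pi.single_apply, Finset.sum_apply] using h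

theorem MvPolynomial.pderiv_rename_eq_zero {R σ τ : Type*} [CommSemiring R] {f : σ → τ} {j : τ}
    (hj : j ∉ Set.range f) (p : MvPolynomial σ R) : pderiv j (rename f p) = 0 := by
  classical
  refine pderiv_eq_zero_of_notMem_vars fun h => hj ?_
  obtain ⟨i, -, hi⟩ := Finset.mem_image.1 (vars_rename f p h)
  exact ⟨i, hi⟩

section

variable {n l m : ℕ} {f : EuclideanSpace ℝ (Fin n) → ℝ}
  {g : Fin l → EuclideanSpace ℝ (Fin n) → ℝ} {h : Fin m → EuclideanSpace ℝ (Fin n) → ℝ}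

open MvPolynomial in
theorem finite_image_criticalSet (hf : IsPolyFun f) (hg : ∀ i, IsPolyFun (g i))
    (hh : ∀ j, IsPolyFun (h j)) : (f '' criticalSet f g h).Finite := by
  obtain ⟨P, hP⟩ := hf
  choose G hG using hg
  choose H hH using hh
  -- The Lagrangian, with the inequality `0 ≤ h j` replaced by `h j = s j ^ 2`.
  let L : MvPolynomial (Fin n ⊕ Fin l ⊕ Fin m ⊕ Fin m) ℝ :=
    rename Sum.inl P - ∑ i, X (.inr (.inl i)) * rename Sum.inl (G i) -
      ∑ j, X (.inr (.inr (.inl j))) * (rename Sum.inl (H j) - X (.inr (.inr (.inr j))) ^ 2)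
  refine (finite_image_eval_of_pderiv_eq_zero L).subset ?_
  rintro _ ⟨x, ⟨⟨hgx, hhx⟩, lam, nu, hgrad, hnu⟩, rfl⟩
  have hren : ∀ z (p : MvPolynomial (Fin n) ℝ), eval (Sum.elim (fun i => x i) z)
      (rename (Sum.inl : Fin n → Fin n ⊕ Fin l ⊕ Fin m ⊕ Fin m) p) = eval (fun i => x i) p :=
    fun z p => by rw [eval_rename, Sum.elim_comp_inl]
  have hinr : ∀ i (p : MvPolynomial (Fin n) ℝ), pderiv (Sum.inr i)
      (rename (Sum.inl : Fin n → Fin n ⊕ Fin l ⊕ Fin m ⊕ Fin m) p) = 0 :=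
    fun i p => pderiv_rename_eq_zero (by simp) p
  have hnu' : ∀ j, nu j = 0 ∨ h j x = 0 := fun j => mul_eq_zero.1 (hnu j)
  refine ⟨Sum.elim (fun i => x i) (Sum.elim lam (Sum.elim nu fun j => √(h j x))), ?_, ?_⟩
  · rintro (i | i | j | j)
    · have := congrArg (fun v : EuclideanSpace ℝ (Fin n) => v i) hgrad
      simpa [L, pderiv_rename Sum.inl_injective, hren, pderiv_X, Pi.single_apply,
        gradient_apply_of_eq_eval hP, gradient_apply_of_eq_eval (hG _),
        gradient_apply_of_eq_eval (hH _), Finset.sum_apply] using this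
    · simp [L, hinr, hren, pderiv_X, Pi.single_apply, apply_ite, ← hG, hgx]
    · simp [L, hinr, hren, pderiv_X, Pi.single_apply, apply_ite, ← hH, Real.sq_sqrt (hhx j)]
    · rcases hnu' j with h0 | h0 <;> simp [L, hinr, pderiv_X, Pi.single_apply, apply_ite, h0]
  · simp [L, hren, ← hP, ← hG, ← hH, hgx, Real.sq_sqrt (hhx _)]

theorem mem_criticalSet_of_isMinOn (hf : IsPolyFun f) (hg : ∀ i, IsPolyFun (g i))
    (hh : ∀ j, IsPolyFun (h j)) (hlicq : LICQ g h) {x : EuclideanSpace ℝ (Fin n)}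
    (hx : x ∈ conSet g h) (hmin : IsMinOn f (conSet g h) x) : x ∈ criticalSet f g h := by
  classical
  let φ : Fin l ⊕ {j : Fin m // h j x = 0} → EuclideanSpace ℝ (Fin n) → ℝ :=
    Sum.elim g fun j => h j.1
  have hφ : ∀ i, IsPolyFun (φ i) := Sum.rec hg fun j => hh j.1
  have hloc : IsLocalExtrOn f {y | ∀ i, φ i y = φ i x} x := by
    refine Or.inl ?_
    have hpos : ∀ᶠ y in nhds x, ∀ j, h j x ≠ 0 → 0 < h j y := by
      refine eventually_all.2 fun j => ?_
      by_cases hj : h j x = 0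
      · simp [hj]
      · filter_upwards [(hh j).continuous.continuousAt.eventually
          (lt_mem_nhds ((hx.2 j).lt_of_ne' hj))] with y hy _ using hy
    filter_upwards [nhdsWithin_le_nhds hpos, self_mem_nhdsWithin] with y hy hyφ
    refine hmin ⟨fun i => (hyφ (.inl i)).trans (hx.1 i), fun j => ?_⟩
    by_cases hj : h j x = 0
    · exact ((hyφ (.inr ⟨j, hj⟩)).trans hj).ge
    · exact (hy j hj).le
  obtain ⟨Λ, Λ₀, hne, hsum⟩ := hloc.exists_multipliers_of_hasStrictFDerivAt
    (fun i => (hφ i).hasStrictFDerivAt x) (hf.hasStrictFDerivAt x)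
  have hsum' : ∑ i, Λ i • gradient (φ i) x + Λ₀ • gradient f x = 0 := by
    apply (InnerProductSpace.toDual ℝ (EuclideanSpace ℝ (Fin n))).injective
    simpa using hsum
  have hΛ₀ : Λ₀ ≠ 0 := by
    rintro rfl
    refine hne (Prod.ext (funext ?_) rfl)
    refine Fintype.linearIndependent_iff.1 (hlicq x hx) Λ ?_
    rw [zero_smul, add_zero] at hsum'
    rw [← hsum']
    refine Finset.sum_congr rfl fun i _ => ?_
    cases i <;> rfl
  refine ⟨hx, fun i => -(Λ₀⁻¹ * Λ (.inl i)),
    fun j => if hj : h j x = 0 then -(Λ₀⁻¹ * Λ (.inr ⟨j, hj⟩)) else 0, ?_, fun j => ?_⟩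
  · have hsub : ∑ j, (if hj : h j x = 0 then -(Λ₀⁻¹ * Λ (.inr ⟨j, hj⟩)) else 0) •
        gradient (h j) x = ∑ j : {j // h j x = 0}, -(Λ₀⁻¹ * Λ (.inr j)) • gradient (h j.1) x := by
      rw [← Fintype.sum_subtype_add_sum_subtype fun j => h j x = 0,
        Finset.sum_eq_zero (s := (Finset.univ : Finset {j // ¬h j x = 0})) fun j _ => by
          rw [dif_neg j.2, zero_smul], add_zero]
      exact Finset.sum_congr rfl fun j _ => by rw [dif_pos j.2]
    rw [hsub]
    have := congrArg (Λ₀⁻¹ • ·) hsum'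
    simp only [Fintype.sum_sum_type, smul_add, Finset.smul_sum, smul_smul, inv_mul_cancel₀ hΛ₀,
      one_smul, smul_zero] at this
    simp only [neg_smul, Finset.sum_neg_distrib, sub_neg_eq_add]
    rw [← this]
    simp only [φ, Sum.elim_inl, Sum.elim_inr]
    abel
  · by_cases hj : h j x = 0 <;> simp [hj]

theorem isClosed_conSet (hg : ∀ i, IsPolyFun (g i)) (hh : ∀ j, IsPolyFun (h j)) :
    IsClosed (conSet g h) := by
  have : conSet g h = (⋂ i, {x | g i x = 0}) ∩ ⋂ j, {x | 0 ≤ h j x} := by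
    ext; simp [conSet]
  rw [this]
  exact (isClosed_iInter fun i => isClosed_eq (hg i).continuous continuous_const).inter
    (isClosed_iInter fun j => isClosed_le continuous_const (hh j).continuous)

theorem psi_norm_le {x : EuclideanSpace ℝ (Fin n)} (hx : x ∈ conSet g h) :
    psi f g h ‖x‖ ≤ f x :=
  sInf_le ⟨x, ⟨hx, rfl⟩, rfl⟩

theorem exists_isMinOn_of_lt_liminf_psi (hf : IsPolyFun f) (hg : ∀ i, IsPolyFun (g i))
    (hh : ∀ j, IsPolyFun (h j)) {y : EuclideanSpace ℝ (Fin n)} (hy : y ∈ conSet g h)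
    (hlt : (f y : EReal) < liminf (psi f g h) atTop) :
    ∃ x ∈ conSet g h, IsMinOn f (conSet g h) x := by
  obtain ⟨T, hT⟩ := eventually_atTop.1 (eventually_lt_of_lt_liminf hlt)
  obtain ⟨z, hz, hzmin⟩ := ((isCompact_closedBall (0 : EuclideanSpace ℝ (Fin n))
    (max T ‖y‖)).inter_left (isClosed_conSet hg hh)).exists_isMinOn
    ⟨y, hy, by simp⟩ hf.continuous.continuousOn
  refine ⟨z, hz.1, fun w hw => ?_⟩
  by_cases hwT : ‖w‖ ≤ max T ‖y‖
  · exact hzmin ⟨hw, by simpa using hwT⟩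
  · have hyw : f y < f w := EReal.coe_lt_coe_iff.1 <|
      (hT ‖w‖ ((le_max_left _ _).trans (not_le.1 hwT).le)).trans_le (psi_norm_le hw)
    exact (show f z ≤ f y from hzmin ⟨hy, by simp⟩).trans hyw.le

end

theorem attains_inf_iff_liminf {n l m : ℕ} (f : EuclideanSpace ℝ (Fin n) → ℝ)
    (g : Fin l → EuclideanSpace ℝ (Fin n) → ℝ) (h : Fin m → EuclideanSpace ℝ (Fin n) → ℝ)
    (hf : IsPolyFun f) (hg : ∀ i, IsPolyFun (g i)) (hh : ∀ j, IsPolyFun (h j))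
    (hS : (conSet g h).Nonempty) (hSu : ¬ Bornology.IsBounded (conSet g h))
    (hlicq : LICQ g h) :
    (∃ x ∈ conSet g h, ∀ y ∈ conSet g h, f x ≤ f y) ↔
      ((criticalSet f g h).Nonempty ∧
        Real.toEReal (sInf (f '' criticalSet f g h)) ≤ Filter.liminf (psi f g h) Filter.atTop) := by
  constructor
  · rintro ⟨x, hx, hmin⟩
    have hxc := mem_criticalSet_of_isMinOn hf hg hh hlicq hx hmin
    refine ⟨⟨x, hxc⟩, ?_⟩
    have hleast : IsLeast (f '' criticalSet f g h) (f x) :=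
      ⟨⟨x, hxc, rfl⟩, by rintro _ ⟨y, hy, rfl⟩; exact hmin y hy.1⟩
    rw [hleast.csInf_eq]
    refine le_liminf_of_le (by isBoundedDefault) (Eventually.of_forall fun t => le_sInf ?_)
    rintro _ ⟨y, ⟨hy, -⟩, rfl⟩
    exact EReal.coe_le_coe_iff.2 (hmin y hy)
  · rintro ⟨hne, hle⟩
    obtain ⟨c, hc, hfc⟩ := (hne.image f).csInf_mem (finite_image_criticalSet hf hg hh)
    by_cases hmin : ∀ y ∈ conSet g h, f c ≤ f y
    · exact ⟨c, hc.1, hmin⟩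
    · push Not at hmin
      obtain ⟨y, hy, hyc⟩ := hmin
      obtain ⟨x, hx, hxmin⟩ := exists_isMinOn_of_lt_liminf_psi hf hg hh hy
        ((EReal.coe_lt_coe_iff.2 (hfc ▸ hyc)).trans_le hle)
      exact ⟨x, hx, hxmin⟩
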